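/- arXiv:2210.00866 — 4 statements merged into one kernel-verified Lean document; each statement's English description precedes it below -/
import Mathlib

section
/- Let n ≥ 1, let b : ℝⁿ → ℝⁿ be a differentiable map with component functions b_i satisfying ∂_i b_j(p) = ∂_j b_i(p) for all i, j and all points p (i.e., the 1-form β with components b_i is closed), and let f : ℝⁿ → ℝ be differentiable. Then the 1-form with components e^f b_i is closed (∂_i(e^f b_j) = ∂_j(e^f b_i) everywhere) if and only if ∂_i f(p) · b_j(p) − ∂_j f(p) · b_i(p) = 0 for all i, j and all points p, i.e., the differential of f is pointwise proportional to β. -/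
/-- If `F = α + β` is a Randers metric of Douglas type (the 1-form `β` with
components `bᵢ` is closed), then the conformally changed 1-form with components
`e^f bᵢ` is closed iff `fᵢ bⱼ − fⱼ bᵢ = 0` everywhere, i.e. `df` is pointwise
proportional to `β`. -/
theorem stmt3 (n : ℕ) (hn : 1 ≤ n) (b : (Fin n → ℝ) → Fin n → ℝ)
    (f : (Fin n → ℝ) → ℝ) (hb : Differentiable ℝ b) (hf : Differentiable ℝ f)
    (hclosed : ∀ (p : Fin n → ℝ) (i j : Fin n),
      fderiv ℝ (fun x => b x j) p (Pi.single i 1) =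
        fderiv ℝ (fun x => b x i) p (Pi.single j 1)) :
    (∀ (p : Fin n → ℝ) (i j : Fin n),
      fderiv ℝ (fun x => Real.exp (f x) * b x j) p (Pi.single i 1) =
        fderiv ℝ (fun x => Real.exp (f x) * b x i) p (Pi.single j 1)) ↔
      (∀ (p : Fin n → ℝ) (i j : Fin n),
        fderiv ℝ f p (Pi.single i 1) * b p j -
          fderiv ℝ f p (Pi.single j 1) * b p i = 0) := by
  have key : ∀ (p v : Fin n → ℝ) (j : Fin n),
      fderiv ℝ (fun x => Real.exp (f x) * b x j) p v =
        Real.exp (f p) * (fderiv ℝ (fun x => b x j) p v + fderiv ℝ f p v * b p j) := by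
    intro p v j
    have h1 : HasFDerivAt (fun x => b x j) (fderiv ℝ (fun x => b x j) p) p :=
      ((differentiable_pi.1 hb j) p).hasFDerivAt
    have h2 := ((hf p).hasFDerivAt.exp).mul h1
    have h3 : HasFDerivAt (fun x => Real.exp (f x) * b x j) _ p := h2
    rw [h3.fderiv]
    simp only [ContinuousLinearMap.add_apply, ContinuousLinearMap.smul_apply, smul_eq_mul]
    ring
  refine forall_congr' fun p => forall_congr' fun i => forall_congr' fun j => ?_
  rw [key, key, hclosed p i j, mul_right_inj' (Real.exp_ne_zero _), add_right_inj, sub_eq_zero]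
end

section
/- Let a, b, c ∈ ℝ and let f : ℝ³ → ℝ be differentiable at a point p = (x, y, z). If the three equations b·f_x(p) − a·f_y(p) − (b y + a x/2)·f_z(p) = c, c·f_x(p) − (c y + a)·f_z(p) = 0, and c·f_y(p) + (c x/2 − b)·f_z(p) = 0 hold at p (where f_x, f_y, f_z denote the partial derivatives of f), then c = 0. -/
/-- The Douglas-type conditions on the Heisenberg group: if the three equations
hold at a point `p = (x,y,z)`, then `c = 0`. -/
theorem stmt5 (a b c : ℝ) (f : ℝ × ℝ × ℝ → ℝ) (p : ℝ × ℝ × ℝ)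
    (hf : DifferentiableAt ℝ f p)
    (h1 : b * fderiv ℝ f p (1, 0, 0) - a * fderiv ℝ f p (0, 1, 0) -
        (b * p.2.1 + a * p.1 / 2) * fderiv ℝ f p (0, 0, 1) = c)
    (h2 : c * fderiv ℝ f p (1, 0, 0) -
        (c * p.2.1 + a) * fderiv ℝ f p (0, 0, 1) = 0)
    (h3 : c * fderiv ℝ f p (0, 1, 0) +
        (c * p.1 / 2 - b) * fderiv ℝ f p (0, 0, 1) = 0) :
    c = 0 := by
  have h : c * c = 0 := by
    linear_combination (-c) * h1 + b * h2 - a * h3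
  exact mul_self_eq_zero.mp h
end

section
/- Let a, b, c ∈ ℝ with a ≠ 0 or b ≠ 0, and let f : ℝ³ → ℝ be differentiable. Then the system of equations b·f_x − a·f_y − (b y + a x/2)·f_z = c, c·f_x − (c y + a)·f_z = 0, c·f_y + (c x/2 − b)·f_z = 0 holds at every point (x,y,z) ∈ ℝ³ if and only if c = 0, f_z(p) = 0 for every p ∈ ℝ³, and b·f_x(p) − a·f_y(p) = 0 for every p ∈ ℝ³. (Here f_x, f_y, f_z denote the partial derivatives of f.) -/
/-- Douglas criterion on the Heisenberg group `H₃`: for `X = a e₁ + b e₂ + c e₃`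
with `a ≠ 0` or `b ≠ 0`, the three Douglas-type equations hold at every point
iff `c = 0`, `∂f/∂z = 0` everywhere and `b ∂f/∂x − a ∂f/∂y = 0` everywhere. -/
theorem stmt6 (a b c : ℝ) (hab : a ≠ 0 ∨ b ≠ 0) (f : ℝ × ℝ × ℝ → ℝ)
    (hf : Differentiable ℝ f) :
    (∀ p : ℝ × ℝ × ℝ,
      b * fderiv ℝ f p (1, 0, 0) - a * fderiv ℝ f p (0, 1, 0) -
          (b * p.2.1 + a * p.1 / 2) * fderiv ℝ f p (0, 0, 1) = c ∧
      c * fderiv ℝ f p (1, 0, 0) -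
          (c * p.2.1 + a) * fderiv ℝ f p (0, 0, 1) = 0 ∧
      c * fderiv ℝ f p (0, 1, 0) +
          (c * p.1 / 2 - b) * fderiv ℝ f p (0, 0, 1) = 0) ↔
      (c = 0 ∧ (∀ p : ℝ × ℝ × ℝ, fderiv ℝ f p (0, 0, 1) = 0) ∧
        ∀ p : ℝ × ℝ × ℝ,
          b * fderiv ℝ f p (1, 0, 0) - a * fderiv ℝ f p (0, 1, 0) = 0) := by
  constructor
  · intro h
    have hc : c = 0 := by
      obtain ⟨h1, h2, h3⟩ := h 0
      have : c * c = 0 := by linear_combination (-c) * h1 + b * h2 - a * h3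
      exact mul_self_eq_zero.mp this
    subst hc
    have hz : ∀ p : ℝ × ℝ × ℝ, fderiv ℝ f p (0, 0, 1) = 0 := by
      intro p
      obtain ⟨-, h2, h3⟩ := h p
      rcases hab with ha | hb
      · exact (mul_eq_zero.mp (by linear_combination -h2 :
          a * fderiv ℝ f p (0, 0, 1) = 0)).resolve_left ha
      · exact (mul_eq_zero.mp (by linear_combination -h3 :
          b * fderiv ℝ f p (0, 0, 1) = 0)).resolve_left hb
    refine ⟨rfl, hz, fun p => ?_⟩
    have h1 := (h p).1
    rw [hz p] at h1
    linear_combination h1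
  · rintro ⟨rfl, hz, h⟩ p
    rw [hz p]
    refine ⟨?_, by ring, by ring⟩
    linear_combination h p
end

section
/- Let a, b ∈ ℝ and let f : ℝ × (0,∞) → ℝ be differentiable. Then the equality ∂/∂x ( e^{f(x,y)} · a / y ) = ∂/∂y ( e^{f(x,y)} · b / y ) holds at every point (x,y) with y > 0 if and only if b·y·f_y(x,y) − a·y·f_x(x,y) = b holds at every point (x,y) with y > 0. (Here f_x, f_y denote the partial derivatives of f; the left-hand condition says that the 1-form e^f (b dx + a dy)/y is closed on the upper half-plane.) -/
theorem stmt10_aux (c : ℝ) (f : ℝ × ℝ → ℝ) (p v : ℝ × ℝ) (hp : 0 < p.2)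
    (hf : DifferentiableAt ℝ f p) :
    fderiv ℝ (fun q : ℝ × ℝ => Real.exp (f q) * c / q.2) p v =
      Real.exp (f p) / p.2 ^ 2 * (c * p.2 * fderiv ℝ f p v - c * v.2) := by
  have h1 := (hf.hasFDerivAt.exp).mul_const c
  have h2 : HasFDerivAt (fun q : ℝ × ℝ => (q.2)⁻¹) _ p :=
    (hasDerivAt_inv hp.ne').comp_hasFDerivAt p (hasFDerivAt_snd (𝕜 := ℝ) (E := ℝ) (F := ℝ) (p := p))
  have h3 := h1.mul h2
  have e : (fun q : ℝ × ℝ => Real.exp (f q) * c / q.2) =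
      (fun q : ℝ × ℝ => Real.exp (f q) * c) * (fun q : ℝ × ℝ => (q.2)⁻¹) := by
    funext q
    simp [div_eq_mul_inv]
  rw [e, h3.fderiv]
  simp
  field_simp
  ring

/-- On the upper half-plane (the solvable Lie group `ℝ ⋊ ℝ⁺`), the 1-form
`e^f (b dx + a dy)/y` is closed iff `b y ∂f/∂y − a y ∂f/∂x = b`. -/
theorem stmt10 (a b : ℝ) (f : ℝ × ℝ → ℝ)
    (hf : ∀ p : ℝ × ℝ, 0 < p.2 → DifferentiableAt ℝ f p) :
    (∀ p : ℝ × ℝ, 0 < p.2 →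
      fderiv ℝ (fun q => Real.exp (f q) * a / q.2) p (1, 0) =
        fderiv ℝ (fun q => Real.exp (f q) * b / q.2) p (0, 1)) ↔
      (∀ p : ℝ × ℝ, 0 < p.2 →
        b * p.2 * fderiv ℝ f p (0, 1) - a * p.2 * fderiv ℝ f p (1, 0) = b) := by
  refine forall_congr' fun p => forall_congr' fun hp => ?_
  rw [stmt10_aux a f p _ hp (hf p hp), stmt10_aux b f p _ hp (hf p hp)]
  have h : Real.exp (f p) / p.2 ^ 2 ≠ 0 := by positivity
  rw [mul_right_inj' h]
  simp only [mul_zero, mul_one, sub_zero]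
  constructor <;> intro h <;> linarith
end
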